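/- arXiv:2004.14229 — 2 statements merged into one kernel-verified Lean document; each statement's English description precedes it below -/
import Mathlib

section
/- Let κ > 0, η₂ > 0, a > 0, and set q = a√3. Let t ⊂ ℝ³ be a nonempty set with diam(t) ≤ q, and m_t ∈ ℝ³ a point with |x − m_t| ≤ q/2 for all x ∈ t. Let 𝒩 be a finite family of pairwise disjoint axis-parallel cubes in ℝ³ of side length a, such that each s ∈ 𝒩 violates the separation criterion or the cone criterion with t, i.e., for each s ∈ 𝒩 either η₂·dist(t,s) < q or η₂·dist(t,s) < κq². Then the number of cubes in 𝒩 is bounded by #𝒩 ≤ 4π√3·(3/2 + 1/η₂)³·max{1, (κq)³}. -/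
open Real

/-- The axis-parallel cube `(o₁,o₁+a] × (o₂,o₂+a] × (o₃,o₃+a]` in `ℝ³` with lower corner `o`
and side length `a`. -/
def cubeSet (o : Fin 3 → ℝ) (a : ℝ) : Set (EuclideanSpace ℝ (Fin 3)) :=
  {x | ∀ i, x i ∈ Set.Ioc (o i) (o i + a)}

/-- The distance between two sets: `dist(t,s) = inf {|x - y| : x ∈ t, y ∈ s}`. -/
noncomputable def setDist (t s : Set (EuclideanSpace ℝ (Fin 3))) : ℝ :=
  sInf (Set.image2 dist t s)

open MeasureTheory

theorem cubeSet_eq_preimage (o : Fin 3 → ℝ) (a : ℝ) :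
    cubeSet o a = WithLp.ofLp ⁻¹' (Set.univ.pi fun i => Set.Ioc (o i) (o i + a)) := by
  ext x
  simp [cubeSet]

theorem volume_cubeSet (o : Fin 3 → ℝ) (a : ℝ) :
    volume (cubeSet o a) = ENNReal.ofReal a ^ 3 := by
  rw [cubeSet_eq_preimage, (PiLp.volume_preserving_ofLp (Fin 3)).measure_preimage
    (MeasurableSet.univ_pi fun _ => measurableSet_Ioc).nullMeasurableSet]
  simp [Real.volume_pi_Ioc]

theorem measurableSet_cubeSet (o : Fin 3 → ℝ) (a : ℝ) : MeasurableSet (cubeSet o a) := by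
  rw [cubeSet_eq_preimage]
  exact (PiLp.volume_preserving_ofLp (Fin 3)).measurable
    (MeasurableSet.univ_pi fun _ => measurableSet_Ioc)

theorem cubeSet_nonempty (o : Fin 3 → ℝ) {a : ℝ} (ha : 0 < a) : (cubeSet o a).Nonempty :=
  ⟨WithLp.toLp 2 fun i => o i + a, fun i => by simp [ha]⟩

theorem dist_le_of_mem_cubeSet {o : Fin 3 → ℝ} {a : ℝ} (ha : 0 < a)
    {x y : EuclideanSpace ℝ (Fin 3)} (hx : x ∈ cubeSet o a) (hy : y ∈ cubeSet o a) :
    dist x y ≤ a * √3 := by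
  have h (i : Fin 3) : dist (x i) (y i) ^ 2 ≤ a ^ 2 := by
    obtain ⟨hx₁, hx₂⟩ := hx i
    obtain ⟨hy₁, hy₂⟩ := hy i
    rw [Real.dist_eq, sq_abs]
    exact sq_le_sq' (by linarith) (by linarith)
  rw [EuclideanSpace.dist_eq]
  refine Real.sqrt_le_iff.2 ⟨by positivity, ?_⟩
  rw [mul_pow, Real.sq_sqrt (by norm_num : (0 : ℝ) ≤ 3), Fin.sum_univ_three]
  linarith [h 0, h 1, h 2]

theorem exists_dist_lt_of_setDist_lt {t s : Set (EuclideanSpace ℝ (Fin 3))} (ht : t.Nonempty)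
    (hs : s.Nonempty) {d : ℝ} (h : setDist t s < d) : ∃ x ∈ t, ∃ y ∈ s, dist x y < d := by
  obtain ⟨_, ⟨x, hx, y, hy, rfl⟩, hxy⟩ := exists_lt_of_csInf_lt (ht.image2 hs) h
  exact ⟨x, hx, y, hy, hxy⟩

/-- Disjoint cubes of side `a` inside a ball of radius `r`: compare volumes. -/
theorem card_mul_pow_le_of_cubeSet_subset_ball {J : Type*} [Fintype J] {o : J → Fin 3 → ℝ}
    {a r : ℝ} (ha : 0 < a) (hr : 0 < r) {m : EuclideanSpace ℝ (Fin 3)}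
    (hdisj : ∀ j k : J, j ≠ k → Disjoint (cubeSet (o j) a) (cubeSet (o k) a))
    (hsub : ∀ j, cubeSet (o j) a ⊆ Metric.ball m r) :
    (Fintype.card J : ℝ) * a ^ 3 ≤ r ^ 3 * (π * 4 / 3) := by
  have h : ∑ j, volume (cubeSet (o j) a) ≤ volume (Metric.ball m r) := by
    rw [← tsum_fintype (L := .unconditional J),
      ← measure_iUnion (fun j k hjk => hdisj j k hjk) fun j => measurableSet_cubeSet (o j) a]
    exact measure_mono (Set.iUnion_subset hsub)
  simp only [volume_cubeSet, EuclideanSpace.volume_ball_fin_three, Finset.sum_const,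
    Finset.card_univ, nsmul_eq_mul] at h
  rw [← ENNReal.ofReal_pow ha.le, ← ENNReal.ofReal_pow hr.le, ← ENNReal.ofReal_natCast,
    ← ENNReal.ofReal_mul (by positivity), ← ENNReal.ofReal_mul (by positivity)] at h
  exact (ENNReal.ofReal_le_ofReal_iff (by positivity)).1 h

/-- Nearfield bound: with `q = a√3`, if `t` has diameter at most `q` and lies in the ball of
radius `q/2` around `m_t`, and `𝒩` is a finite family of pairwise disjoint axis-parallel
cubes of side `a`, each violating the separation criterion `q ≤ η₂·dist(t,s)` or the cone
criterion `κq² ≤ η₂·dist(t,s)` with `t`, then `#𝒩 ≤ 4π√3·(3/2 + 1/η₂)³·max{1, (κq)³}`. -/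
theorem card_nearfield_bound (κ η₂ a : ℝ) (hκ : 0 < κ) (hη : 0 < η₂) (ha : 0 < a)
    (t : Set (EuclideanSpace ℝ (Fin 3))) (ht : t.Nonempty) (m_t : EuclideanSpace ℝ (Fin 3))
    (hdiam : Metric.diam t ≤ a * Real.sqrt 3)
    (hmt : ∀ x ∈ t, dist x m_t ≤ a * Real.sqrt 3 / 2)
    {J : Type*} [Fintype J] (o : J → Fin 3 → ℝ)
    (hdisj : ∀ j k : J, j ≠ k → Disjoint (cubeSet (o j) a) (cubeSet (o k) a))
    (hviol : ∀ j : J,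
      η₂ * setDist t (cubeSet (o j) a) < a * Real.sqrt 3 ∨
      η₂ * setDist t (cubeSet (o j) a) < κ * (a * Real.sqrt 3) ^ 2) :
    (Fintype.card J : ℝ) ≤
      4 * π * Real.sqrt 3 * (3 / 2 + 1 / η₂) ^ 3 * max 1 ((κ * (a * Real.sqrt 3)) ^ 3) := by
  set q : ℝ := a * √3 with hq
  have hq₀ : 0 < q := by positivity
  set M : ℝ := max 1 (κ * q) with hM
  have hM₁ : 1 ≤ M := le_max_left _ _
  have hMκ : κ * q ≤ M := le_max_right _ _
  have hM₃ : M ^ 3 = max 1 ((κ * q) ^ 3) := by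
    have h1 : 1 ≤ max 1 ((κ * q) ^ 3) := le_max_left _ _
    rcases le_total (κ * q) 1 with h | h
    · rw [hM, max_eq_left h, max_eq_left (pow_le_one₀ (by positivity) h), one_pow]
    · rw [hM, max_eq_right h, max_eq_right (one_le_pow₀ h)]
  have hsub (j : J) : cubeSet (o j) a ⊆ Metric.ball m_t (q * M * (3 / 2 + 1 / η₂)) := by
    have hd : setDist t (cubeSet (o j) a) < q * M / η₂ := by
      rw [lt_div_iff₀' hη]
      rcases hviol j with h | h <;> nlinarith
    obtain ⟨x, hx, y, hy, hxy⟩ := exists_dist_lt_of_setDist_lt ht (cubeSet_nonempty (o j) ha) hd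
    intro z hz
    have hzy : dist z y ≤ q := dist_le_of_mem_cubeSet ha hz hy
    have hxm := hmt x hx
    rw [dist_comm] at hxy
    have htri := dist_triangle4 z y x m_t
    have hqM : q ≤ q * M := le_mul_of_one_le_right hq₀.le hM₁
    have hexp : q * M * (3 / 2 + 1 / η₂) = 3 / 2 * (q * M) + q * M / η₂ := by ring
    rw [Metric.mem_ball, hexp]
    linarith
  have hvol := card_mul_pow_le_of_cubeSet_subset_ball ha (by positivity) hdisj hsub
  have hq₃ : q ^ 3 = 3 * √3 * a ^ 3 := by
    rw [hq, mul_pow, pow_succ √3, Real.sq_sqrt (by norm_num)]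
    ring
  rw [← hM₃]
  refine le_of_mul_le_mul_right (hvol.trans_eq ?_) (pow_pos ha 3)
  rw [mul_pow, mul_pow, hq₃]
  ring
end

section
/- Let C ≥ 1 and K > 0 be real numbers. Then for every natural number ℓ, min{8^{2ℓ}, C·max{1, K³·8^{−ℓ}}} ≤ max{C, C^{2/3}·K²}. Consequently, ∑_{ℓ=1}^{p} min{8^{2ℓ}, C·max{1, K³·8^{−ℓ}}} ≤ p·max{C, C^{2/3}·K²} for every natural number p ≥ 1. -/
theorem min_sq_cube_div_le_sq {x d : ℝ} (hx : 0 < x) (hd : 0 ≤ d) :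
    min (x ^ 2) (d ^ 3 / x) ≤ d ^ 2 := by
  rcases le_total x d with h | h
  · exact (min_le_left _ _).trans (pow_le_pow_left₀ hx.le h 2)
  · refine (min_le_right _ _).trans ((div_le_iff₀ hx).2 ?_)
    rw [pow_succ]
    gcongr

theorem min_sq_mul_max_le {C K x : ℝ} (hC : 0 ≤ C) (hK : 0 ≤ K) (hx : 0 < x) :
    min (x ^ 2) (C * max 1 (K ^ 3 / x)) ≤ max C (C ^ ((2 : ℝ) / 3) * K ^ 2) := by
  have hcube : (C ^ ((1 : ℝ) / 3)) ^ 3 = C := by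
    rw [← Real.rpow_natCast, ← Real.rpow_mul hC]
    norm_num
  have hsq : (C ^ ((1 : ℝ) / 3)) ^ 2 = C ^ ((2 : ℝ) / 3) := by
    rw [← Real.rpow_natCast, ← Real.rpow_mul hC]
    norm_num
  have h := min_sq_cube_div_le_sq hx (d := C ^ ((1 : ℝ) / 3) * K) (by positivity)
  rw [mul_pow, mul_pow, hcube, hsq, mul_div_assoc] at h
  rw [mul_max_of_nonneg _ _ hC, mul_one, min_max_distrib_left]
  exact max_le_max (min_le_right _ _) h

/-- Arithmetic core of the bound on the number of stored coupling matrices: for `C ≥ 1` and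
`K > 0`, `min{8^{2ℓ}, C·max{1, K³·8^{−ℓ}}} ≤ max{C, C^{2/3}·K²}` for every level `ℓ`, and
hence `∑_{ℓ=1}^{p} min{8^{2ℓ}, C·max{1, K³·8^{−ℓ}}} ≤ p·max{C, C^{2/3}·K²}`. -/
theorem stored_coupling_matrix_count (C K : ℝ) (hC : 1 ≤ C) (hK : 0 < K) :
    (∀ ℓ : ℕ, min ((8 : ℝ) ^ (2 * ℓ)) (C * max 1 (K ^ 3 * (8 : ℝ) ^ (-(ℓ : ℤ)))) ≤
      max C (C ^ ((2 : ℝ) / 3) * K ^ 2)) ∧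
    (∀ p : ℕ, 1 ≤ p →
      (∑ ℓ ∈ Finset.Icc 1 p, min ((8 : ℝ) ^ (2 * ℓ)) (C * max 1 (K ^ 3 * (8 : ℝ) ^ (-(ℓ : ℤ))))) ≤
        (p : ℝ) * max C (C ^ ((2 : ℝ) / 3) * K ^ 2)) := by
  have hlevel : ∀ ℓ : ℕ, min ((8 : ℝ) ^ (2 * ℓ)) (C * max 1 (K ^ 3 * (8 : ℝ) ^ (-(ℓ : ℤ)))) ≤
      max C (C ^ ((2 : ℝ) / 3) * K ^ 2) := by
    intro ℓ
    rw [mul_comm 2 ℓ, pow_mul, zpow_neg, zpow_natCast, ← div_eq_mul_inv]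
    exact min_sq_mul_max_le (by linarith) hK.le (by positivity)
  refine ⟨hlevel, fun p _ => ?_⟩
  simpa using Finset.sum_le_card_nsmul (Finset.Icc 1 p) _ _ fun ℓ _ => hlevel ℓ
end
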